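/- Fix n ≥ 1 and k : Fin n → ℕ with 2 ≤ k i for all i, and let K = ∏_{i} k i. The potential games form a linear subspace of the game space, and its dimension (finrank over ℝ) equals K + Σ_{i : Fin n} ∏_{j ≠ i} k j − 1. -/

import Mathlib

/-- A game is potential if it admits a potential function. -/
def IsPotentialGame {n : ℕ} {k : Fin n → ℕ}
    (c : Fin n → (((i : Fin n) → Fin (k i)) → ℝ)) : Prop :=
  ∃ φ : ((i : Fin n) → Fin (k i)) → ℝ,
    ∀ (i : Fin n) (x y : Fin (k i)) (s : (i : Fin n) → Fin (k i)),
      c i (Function.update s i x) - c i (Function.update s i y) =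
        φ (Function.update s i x) - φ (Function.update s i y)

/-- A function on a finite product that is invariant under changing any single coordinate
is constant. -/
theorem eq_of_forall_update_eq {ι α : Type*} [Fintype ι] [DecidableEq ι] {β : ι → Type*}
    {f : (∀ i, β i) → α} (h : ∀ s i x, f (Function.update s i x) = f s) (s t : ∀ i, β i) :
    f s = f t := by
  have key : ∀ A : Finset ι, f (A.piecewise s t) = f t := by
    intro A
    induction A using Finset.induction_on with
    | empty => simp
    | insert a A _ ih => rw [Finset.piecewise_insert, h, ih]
  simpa using key Finset.univ

/-- The game in which player `i` receives the common payoff `p.1` plus a term `p.2 i` that does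
not depend on the strategy of player `i`. -/
def gameOfPotential {n : ℕ} (k : Fin n → ℕ) :
    ((((i : Fin n) → Fin (k i)) → ℝ) ×
      ((i : Fin n) → (((j : {j // j ≠ i}) → Fin (k j)) → ℝ))) →ₗ[ℝ]
      (Fin n → (((i : Fin n) → Fin (k i)) → ℝ)) where
  toFun p i s := p.1 s + p.2 i (fun j => s j)
  map_add' p q := by
    ext i s
    simp only [Prod.fst_add, Prod.snd_add, Pi.add_apply]
    ring
  map_smul' a p := by
    ext i s
    simp only [Prod.smul_fst, Prod.smul_snd, Pi.smul_apply, smul_eq_mul, RingHom.id_apply]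
    ring

theorem gameOfPotential_apply {n : ℕ} {k : Fin n → ℕ}
    (p : (((i : Fin n) → Fin (k i)) → ℝ) ×
      ((i : Fin n) → (((j : {j // j ≠ i}) → Fin (k j)) → ℝ)))
    (i : Fin n) (s : (i : Fin n) → Fin (k i)) :
    gameOfPotential k p i s = p.1 s + p.2 i (fun j => s j) := rfl

theorem restrict_update {n : ℕ} {k : Fin n → ℕ} (s : (i : Fin n) → Fin (k i)) (i : Fin n)
    (x : Fin (k i)) :
    (fun j : {j // j ≠ i} => Function.update s i x j) = fun j : {j // j ≠ i} => s j := by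
  ext j
  rw [Function.update_of_ne j.2]

/-- Extend a profile of the opponents of player `i` by the strategy of `i` in `s₀`. -/
def extendProfile {n : ℕ} {k : Fin n → ℕ} (s₀ : (i : Fin n) → Fin (k i)) (i : Fin n)
    (r : (j : {j // j ≠ i}) → Fin (k j)) : (j : Fin n) → Fin (k j) :=
  fun j => if h : j = i then s₀ j else r ⟨j, h⟩

theorem extendProfile_restrict {n : ℕ} {k : Fin n → ℕ} (s₀ s : (i : Fin n) → Fin (k i))
    (i : Fin n) :
    extendProfile s₀ i (fun j => s j) = Function.update s i (s₀ i) := by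
  funext j
  by_cases h : j = i
  · subst h
    simp [extendProfile]
  · simp [extendProfile, h]

theorem restrict_extendProfile {n : ℕ} {k : Fin n → ℕ} (s₀ : (i : Fin n) → Fin (k i))
    (i : Fin n) (r : (j : {j // j ≠ i}) → Fin (k j)) :
    (fun j : {j // j ≠ i} => extendProfile s₀ i r j) = r := by
  funext j
  simp [extendProfile, j.2]

theorem mem_range_gameOfPotential_iff {n : ℕ} {k : Fin n → ℕ} (s₀ : (i : Fin n) → Fin (k i))
    (c : Fin n → (((i : Fin n) → Fin (k i)) → ℝ)) :
    c ∈ LinearMap.range (gameOfPotential k) ↔ IsPotentialGame c := by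
  constructor
  · rintro ⟨p, rfl⟩
    refine ⟨p.1, fun i x y s => ?_⟩
    simp only [gameOfPotential_apply, restrict_update]
    ring
  · rintro ⟨φ, hφ⟩
    refine ⟨(φ, fun i r => c i (extendProfile s₀ i r) - φ (extendProfile s₀ i r)), ?_⟩
    ext i s
    have h := hφ i (s i) (s₀ i) s
    rw [Function.update_eq_self] at h
    rw [gameOfPotential_apply]
    simp only [extendProfile_restrict]
    linarith

theorem ker_gameOfPotential {n : ℕ} {k : Fin n → ℕ}
    (s₀ : (i : Fin n) → Fin (k i)) :
    LinearMap.ker (gameOfPotential k) = Submodule.span ℝ {((fun _ => 1), (fun _ _ => -1))} := by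
  ext p
  rw [LinearMap.mem_ker, Submodule.mem_span_singleton]
  constructor
  · intro hp
    have hp' : ∀ i s, p.1 s + p.2 i (fun j => s j) = 0 := fun i s => by
      rw [← gameOfPotential_apply, hp]
      rfl
    have hconst : ∀ s, p.1 s = p.1 s₀ := fun s => by
      refine eq_of_forall_update_eq (fun s i x => ?_) s s₀
      have h₁ := hp' i (Function.update s i x)
      rw [restrict_update] at h₁
      linarith [hp' i s]
    refine ⟨p.1 s₀, Prod.ext ?_ ?_⟩
    · funext s
      simp [hconst s]
    · funext i r
      have h := hp' i (extendProfile s₀ i r)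
      rw [restrict_extendProfile, hconst] at h
      simp only [Prod.smul_snd, Pi.smul_apply, smul_eq_mul]
      linarith
  · rintro ⟨a, rfl⟩
    ext i s
    simp [gameOfPotential_apply]

theorem potential_subspace_dim (n : ℕ) (hn : 1 ≤ n) (k : Fin n → ℕ)
    (hk : ∀ i, 2 ≤ k i) :
    ∃ P : Submodule ℝ (Fin n → (((i : Fin n) → Fin (k i)) → ℝ)),
      (∀ c, c ∈ P ↔ IsPotentialGame c) ∧
      Module.finrank ℝ P =
        (∏ i : Fin n, k i) + (∑ i : Fin n, ∏ j ∈ Finset.univ.erase i, k j) - 1 := by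
  have s₀ : (i : Fin n) → Fin (k i) := fun i => ⟨0, by have := hk i; omega⟩
  refine ⟨LinearMap.range (gameOfPotential k), mem_range_gameOfPotential_iff s₀, ?_⟩
  have hdim := LinearMap.finrank_range_add_finrank_ker (gameOfPotential k)
  have hne : (((fun _ => 1), (fun _ _ => -1)) : (((i : Fin n) → Fin (k i)) → ℝ) ×
      ((i : Fin n) → (((j : {j // j ≠ i}) → Fin (k j)) → ℝ))) ≠ 0 := fun h => by
    simpa using congrFun (congrArg Prod.fst h) s₀
  have hprod : ∀ i : Fin n,
      ∏ j : {j // j ≠ i}, k j = ∏ j ∈ Finset.univ.erase i, k j := fun i =>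
    (Finset.prod_subtype _ (by simp) k).symm
  rw [ker_gameOfPotential s₀, finrank_span_singleton hne, Module.finrank_prod,
    Module.finrank_fintype_fun_eq_card, Module.finrank_pi_fintype] at hdim
  simp only [Module.finrank_fintype_fun_eq_card, Fintype.card_pi, Fintype.card_fin, hprod] at hdim
  omega
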